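/- arXiv:2507.12626 — 8 statements merged into one kernel-verified Lean document; each statement's English description precedes it below -/
import Mathlib

section
/- A circuit (n,1,f) is feasible if and only if f is a threshold function, that is, if and only if there exist w_0 ∈ ℝ and w ∈ ℝ^n such that w_0 + w·x ≠ 0 and f(x) = sgn(w_0 + w·x) for every x ∈ Σ^n. -/
open Finset

def IsSpin {d : ℕ} (s : Fin d → ℝ) : Prop := ∀ i, s i = -1 ∨ s i = 1

def StrictUpper {d : ℕ} (J : Matrix (Fin d) (Fin d) ℝ) : Prop :=
  ∀ i j : Fin d, ¬ i < j → J i j = 0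

noncomputable def isingH {d : ℕ} (h : Fin d → ℝ) (J : Matrix (Fin d) (Fin d) ℝ)
    (s : Fin d → ℝ) : ℝ :=
  (∑ i, h i * s i) + ∑ i, ∑ j, if i < j then J i j * s i * s j else 0

def Encodes {n m : ℕ} (H : (Fin (n + m) → ℝ) → ℝ)
    (f : (Fin n → ℝ) → (Fin m → ℝ)) : Prop :=
  ∀ x, IsSpin x → ∀ y, IsSpin y → y ≠ f x →
    H (Fin.append x (f x)) < H (Fin.append x y)

def Feasible (n m : ℕ) (f : (Fin n → ℝ) → (Fin m → ℝ)) : Prop :=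
  ∃ (h : Fin (n + m) → ℝ) (J : Matrix (Fin (n + m)) (Fin (n + m)) ℝ),
    StrictUpper J ∧ Encodes (isingH h J) f

/-- The local field that the inputs `x` exert on the single output spin. -/
def outputField {n : ℕ} (h : Fin (n + 1) → ℝ) (J : Matrix (Fin (n + 1)) (Fin (n + 1)) ℝ)
    (x : Fin n → ℝ) : ℝ :=
  h (Fin.natAdd n 0) + ∑ i, J (Fin.castAdd 1 i) (Fin.natAdd n 0) * x i

theorem isingH_append_single {n : ℕ} (h : Fin (n + 1) → ℝ)
    (J : Matrix (Fin (n + 1)) (Fin (n + 1)) ℝ) (x : Fin n → ℝ) (y : Fin 1 → ℝ) :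
    isingH h J (Fin.append x y) =
      isingH (fun i => h (Fin.castAdd 1 i))
        (J.submatrix (Fin.castAdd 1) (Fin.castAdd 1)) x + outputField h J x * y 0 := by
  have hlt (i : Fin n) : Fin.castAdd 1 i < Fin.natAdd n (0 : Fin 1) := by
    simp [Fin.lt_def]
  have hcast (i j : Fin n) : Fin.castAdd 1 i < Fin.castAdd 1 j ↔ i < j := Iff.rfl
  simp only [isingH, outputField, Fin.sum_univ_add, Fin.append_left, Fin.append_right,
    Finset.univ_unique, Finset.sum_singleton, Fin.default_eq_zero, hlt, hcast,
    (hlt _).not_gt, lt_irrefl, if_true, if_false, Finset.sum_add_distrib,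
    Finset.sum_const_zero, Matrix.submatrix_apply, add_mul, Finset.sum_mul]
  ring

theorem encodes_single_iff {n : ℕ} (h : Fin (n + 1) → ℝ)
    (J : Matrix (Fin (n + 1)) (Fin (n + 1)) ℝ) (f : (Fin n → ℝ) → (Fin 1 → ℝ))
    (hf : ∀ x, IsSpin x → IsSpin (f x)) :
    Encodes (isingH h J) f ↔ ∀ x, IsSpin x → outputField h J x * f x 0 < 0 := by
  refine forall₂_congr fun x hx => ?_
  simp only [isingH_append_single, add_lt_add_iff_left]
  have hfx := hf x hx 0
  constructor
  · intro H
    have := H (fun _ => -f x 0) (fun _ => by rcases hfx with h | h <;> simp [h])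
      (fun e => by
        have := congrFun e 0
        rcases hfx with h | h <;> rw [h] at this <;> norm_num at this)
    linarith
  · intro H y hy hne
    have hy0 : y 0 = -f x 0 := by
      have hne0 : y 0 ≠ f x 0 := fun e => hne (funext fun i => by rwa [Subsingleton.elim i 0])
      rcases hfx with h | h <;> rcases hy 0 with h' | h' <;> simp_all
    rw [hy0]
    linarith

theorem ne_zero_and_eq_sign_iff {s t : ℝ} (hs : s = -1 ∨ s = 1) :
    (t ≠ 0 ∧ s = Real.sign t) ↔ 0 < t * s := by
  rcases lt_trichotomy t 0 with ht | rfl | ht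
  · rw [Real.sign_of_neg ht]
    rcases hs with rfl | rfl <;> norm_num [ht, ht.ne, ht.le]
  · simp
  · rw [Real.sign_of_pos ht]
    rcases hs with rfl | rfl <;> norm_num [ht, ht.ne', ht.le]

/-- a circuit `(n,1,f)` is feasible iff `f` is a threshold function. -/
theorem statement1 (n : ℕ) (f : (Fin n → ℝ) → (Fin 1 → ℝ))
    (hf : ∀ x, IsSpin x → IsSpin (f x)) :
    Feasible n 1 f ↔
      ∃ (w₀ : ℝ) (w : Fin n → ℝ), ∀ x, IsSpin x →
        w₀ + (∑ i, w i * x i) ≠ 0 ∧ f x 0 = Real.sign (w₀ + ∑ i, w i * x i) := by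
  constructor
  · rintro ⟨h, J, -, hE⟩
    rw [encodes_single_iff h J f hf] at hE
    refine ⟨-h (Fin.natAdd n 0), fun i => -J (Fin.castAdd 1 i) (Fin.natAdd n 0), fun x hx => ?_⟩
    rw [ne_zero_and_eq_sign_iff (hf x hx 0)]
    have := hE x hx
    simp only [outputField] at this
    simp only [neg_mul, Finset.sum_neg_distrib]
    linarith
  · rintro ⟨w₀, w, hw⟩
    refine ⟨Fin.append 0 fun _ => -w₀,
      Matrix.of fun i j => Fin.append (fun k => Fin.append 0 (fun _ => -w k) j) 0 i, ?_, ?_⟩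
    · intro i j
      refine Fin.addCases (fun k => ?_) (fun k => ?_) i
      · refine Fin.addCases (fun l => ?_) (fun l => ?_) j
        · simp
        · exact fun hn => absurd (by simp [Fin.lt_def]) hn
      · simp
    · rw [encodes_single_iff _ _ f hf]
      intro x hx
      have := (ne_zero_and_eq_sign_iff (hf x hx 0)).1 (hw x hx)
      simp only [outputField, Matrix.of_apply, Fin.append_left, Fin.append_right, neg_mul,
        Finset.sum_neg_distrib]
      linarith
end

section
/- There exists an Ising Hamiltonian that encodes a circuit (n,m,f) if and only if there exists a generic Ising Hamiltonian that encodes (n,m,f), where H is generic when all its energy levels are distinct, i.e., H(α) = H(β) implies α = β for all α, β ∈ Σ^{n+m}. -/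
open Finset

/-- An Ising Hamiltonian is generic when all energy levels of spin states are distinct. -/
def Generic {d : ℕ} (H : (Fin d → ℝ) → ℝ) : Prop :=
  ∀ α β : Fin d → ℝ, IsSpin α → IsSpin β → H α = H β → α = β

open Filter Topology

theorem finite_setOf_isSpin (d : ℕ) : {s : Fin d → ℝ | IsSpin s}.Finite := by
  refine (Set.Finite.pi (t := fun _ : Fin d => ({-1, 1} : Set ℝ))
    fun _ => Set.toFinite _).subset fun s hs i _ => ?_
  simpa using hs i

/-- The external field `h` perturbed by successive powers of `ε`. -/
def perturbField {d : ℕ} (h : Fin d → ℝ) (ε : ℝ) : Fin d → ℝ :=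
  fun i => h i + ε ^ (i.val + 1)

theorem isingH_perturbField {d : ℕ} (h : Fin d → ℝ) (J : Matrix (Fin d) (Fin d) ℝ)
    (ε : ℝ) (s : Fin d → ℝ) :
    isingH (perturbField h ε) J s = isingH h J s + ∑ i : Fin d, ε ^ (i.val + 1) * s i := by
  simp only [isingH, perturbField, add_mul, sum_add_distrib]
  ring

theorem eventually_isingH_perturbField_lt {d : ℕ} {h : Fin d → ℝ}
    {J : Matrix (Fin d) (Fin d) ℝ} {α β : Fin d → ℝ} (hlt : isingH h J α < isingH h J β) :
    ∀ᶠ ε in 𝓝[≠] (0 : ℝ), isingH (perturbField h ε) J α < isingH (perturbField h ε) J β := by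
  simp only [isingH_perturbField]
  apply eventually_nhdsWithin_of_eventually_nhds
  refine ContinuousAt.eventually_lt (by fun_prop) (by fun_prop) ?_
  simpa using hlt

theorem eventually_isingH_perturbField_ne {d : ℕ} (h : Fin d → ℝ)
    (J : Matrix (Fin d) (Fin d) ℝ) {α β : Fin d → ℝ} (hne : α ≠ β) :
    ∀ᶠ ε in 𝓝[≠] (0 : ℝ), isingH (perturbField h ε) J α ≠ isingH (perturbField h ε) J β := by
  let p : Polynomial ℝ := Polynomial.C (isingH h J α - isingH h J β) +
    ∑ i : Fin d, Polynomial.C (α i - β i) * Polynomial.X ^ (i.val + 1)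
  have hp : p ≠ 0 := by
    obtain ⟨j, hj⟩ := Function.ne_iff.mp hne
    intro h0
    have hc : p.coeff (j.val + 1) = α j - β j := by
      simp [p, Polynomial.coeff_X_pow, Fin.val_inj, -map_sub]
    rw [h0, Polynomial.coeff_zero] at hc
    exact hj (sub_eq_zero.mp hc.symm)
  have hroots : ∀ᶠ ε in 𝓝[≠] (0 : ℝ), ε ∉ p.rootSet ℝ :=
    nhdsNE_le_cofinite 0 (p.rootSet_finite ℝ).compl_mem_cofinite
  filter_upwards [hroots] with ε hε heq
  apply hε
  rw [Polynomial.mem_rootSet]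
  refine ⟨hp, ?_⟩
  simp only [isingH_perturbField] at heq
  simp only [p, map_add, map_sum, map_mul, map_pow, Polynomial.aeval_C, Polynomial.aeval_X,
    Algebra.algebraMap_self, RingHom.id_apply, sub_mul, sum_sub_distrib]
  simp only [mul_comm (_ ^ _)] at heq
  linarith

/-- there is an Ising Hamiltonian encoding `(n,m,f)` iff there is a
generic Ising Hamiltonian encoding `(n,m,f)`. -/
theorem statement2 (n m : ℕ) (f : (Fin n → ℝ) → (Fin m → ℝ))
    (hf : ∀ x, IsSpin x → IsSpin (f x)) :
    (∃ (h : Fin (n + m) → ℝ) (J : Matrix (Fin (n + m)) (Fin (n + m)) ℝ),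
        StrictUpper J ∧ Encodes (isingH h J) f) ↔
    (∃ (h : Fin (n + m) → ℝ) (J : Matrix (Fin (n + m)) (Fin (n + m)) ℝ),
        StrictUpper J ∧ Encodes (isingH h J) f ∧ Generic (isingH h J)) := by
  constructor
  · rintro ⟨h, J, hJ, henc⟩
    have hlt : ∀ᶠ ε in 𝓝[≠] (0 : ℝ), ∀ x ∈ {x : Fin n → ℝ | IsSpin x},
        ∀ y ∈ {y : Fin m → ℝ | IsSpin y}, y ≠ f x →
          isingH (perturbField h ε) J (Fin.append x (f x)) <
            isingH (perturbField h ε) J (Fin.append x y) := by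
      rw [eventually_all_finite (finite_setOf_isSpin n)]
      intro x hx
      rw [eventually_all_finite (finite_setOf_isSpin m)]
      intro y hy
      rw [eventually_imp_distrib_left]
      exact fun hne => eventually_isingH_perturbField_lt (henc x hx y hy hne)
    have hgen : ∀ᶠ ε in 𝓝[≠] (0 : ℝ), ∀ α ∈ {α : Fin (n + m) → ℝ | IsSpin α},
        ∀ β ∈ {β : Fin (n + m) → ℝ | IsSpin β}, α ≠ β →
          isingH (perturbField h ε) J α ≠ isingH (perturbField h ε) J β := by
      rw [eventually_all_finite (finite_setOf_isSpin _)]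
      intro α _
      rw [eventually_all_finite (finite_setOf_isSpin _)]
      intro β _
      rw [eventually_imp_distrib_left]
      exact eventually_isingH_perturbField_ne h J
    obtain ⟨ε, hε, hε'⟩ := (hlt.and hgen).exists
    exact ⟨perturbField h ε, J, hJ, hε, fun α β hα hβ heq =>
      by_contra fun hne => hε' α hα β hβ hne heq⟩
  · rintro ⟨h, J, hJ, henc, _⟩
    exact ⟨h, J, hJ, henc⟩
end

section
/- Let B : ℝ^m → ℝ^n be an injective affine map, B(y) = Ty + b, and let J_T be the strictly upper-triangular part of TᵀT. Then for every y ∈ Σ^m, the image of the Voronoi cell of B(y) in the point set B(Σ^m) under the map x ↦ −B*(x) equals the minimizing cell of y: (−B*)( V_{B(Σ^m)}(B y) ) = C_{J_T}(y), where B*(x) = Tᵀ(x − b) is the pseudo-adjoint of B. -/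
open Finset Matrix

/-- The Euclidean norm on `Fin n → ℝ`. -/
noncomputable def euclNorm {n : ℕ} (v : Fin n → ℝ) : ℝ := Real.sqrt (∑ i, (v i) ^ 2)

/-- The Voronoi cell of `p` in the point set `S` (Euclidean distance). -/
def VorCell {n : ℕ} (S : Set (Fin n → ℝ)) (p : Fin n → ℝ) : Set (Fin n → ℝ) :=
  {x | ∀ q ∈ S, q ≠ p → euclNorm (x - p) < euclNorm (x - q)}

/-- The residual Ising Hamiltonian `E_J(a, y) = a · y + yᵀ J y`. -/
noncomputable def EJ {m : ℕ} (J : Matrix (Fin m) (Fin m) ℝ) (a y : Fin m → ℝ) : ℝ :=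
  (∑ i, a i * y i) + ∑ i, ∑ j, J i j * y i * y j

/-- The minimizing cell `C_J(y)`. -/
def MinCell {m : ℕ} (J : Matrix (Fin m) (Fin m) ℝ) (y : Fin m → ℝ) : Set (Fin m → ℝ) :=
  {a | ∀ z, IsSpin z → z ≠ y → EJ J a y < EJ J a z}

/-- The strictly upper-triangular part of a square matrix. -/
def upperPart {m : ℕ} (M : Matrix (Fin m) (Fin m) ℝ) : Matrix (Fin m) (Fin m) ℝ :=
  Matrix.of fun i j => if i < j then M i j else 0

/-- On spin vectors, a symmetric quadratic form is its trace plus twice its strictly upper part. -/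
lemma IsSpin.quadratic_form_eq {m : ℕ} {M : Matrix (Fin m) (Fin m) ℝ} (hM : M.IsSymm)
    {z : Fin m → ℝ} (hz : IsSpin z) :
    z ⬝ᵥ M *ᵥ z = M.trace + 2 * ∑ i, ∑ j, upperPart M i j * z i * z j := by
  have hterm : ∀ i j, z i * (M i j * z j) = (if i = j then M i i else 0) +
      upperPart M i j * z i * z j + upperPart M j i * z j * z i := by
    intro i j
    have hsq : z i * z i = 1 := by rcases hz i with h | h <;> simp [h]
    simp only [upperPart, Matrix.of_apply]
    rcases lt_trichotomy i j with h | rfl | h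
    · simp only [h.ne, h, h.not_gt, if_true, if_false]
      ring
    · simp only [lt_irrefl, if_true, if_false]
      linear_combination M i i * hsq
    · simp only [h.ne', h, h.not_gt, if_true, if_false, hM.apply i j]
      ring
  have hswap : ∑ i, ∑ j, upperPart M j i * z j * z i = ∑ i, ∑ j, upperPart M i j * z i * z j :=
    Finset.sum_comm
  simp only [dotProduct, mulVec, Finset.mul_sum, hterm, Finset.sum_add_distrib, hswap]
  simp only [← Finset.mul_sum, Finset.sum_ite_eq, Finset.mem_univ, if_true, Matrix.trace,
    Matrix.diag_apply]
  ring

/-- The squared distance to the image of a spin vector is twice its residual energy, up to a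
constant independent of the spin vector. -/
lemma IsSpin.sum_sq_sub_eq {n m : ℕ} (T : Matrix (Fin n) (Fin m) ℝ) (b x : Fin n → ℝ)
    {z : Fin m → ℝ} (hz : IsSpin z) :
    ∑ i, ((x - (T *ᵥ z + b)) i) ^ 2 = (x - b) ⬝ᵥ (x - b) + (Tᵀ * T).trace +
      2 * EJ (upperPart (Tᵀ * T)) (-(Tᵀ *ᵥ (x - b))) z := by
  have hquad := hz.quadratic_form_eq (M := Tᵀ * T) (by simp [Matrix.IsSymm, Matrix.transpose_mul])
  have hlin : ∑ i, (-(Tᵀ *ᵥ (x - b))) i * z i = -((x - b) ⬝ᵥ T *ᵥ z) := by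
    rw [Matrix.dotProduct_mulVec, ← Matrix.mulVec_transpose, ← neg_dotProduct]
    rfl
  have hform : z ⬝ᵥ (Tᵀ * T) *ᵥ z = T *ᵥ z ⬝ᵥ T *ᵥ z := by
    rw [← Matrix.mulVec_mulVec, Matrix.dotProduct_mulVec, Matrix.vecMul_transpose]
  have hexpand : ∑ i, ((x - (T *ᵥ z + b)) i) ^ 2 =
      (x - b - T *ᵥ z) ⬝ᵥ (x - b - T *ᵥ z) := by
    rw [add_comm, ← sub_sub]
    simp only [dotProduct, sq]
  rw [hexpand, EJ, hlin]
  simp only [sub_dotProduct (x - b), dotProduct_sub _ (x - b), dotProduct_comm (T *ᵥ z) (x - b)]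
  linarith

/-- Comparing distances to images of spin vectors amounts to comparing residual energies. -/
lemma euclNorm_sub_lt_iff_EJ_lt {n m : ℕ} (T : Matrix (Fin n) (Fin m) ℝ) (b x : Fin n → ℝ)
    {y z : Fin m → ℝ} (hy : IsSpin y) (hz : IsSpin z) :
    euclNorm (x - (T *ᵥ y + b)) < euclNorm (x - (T *ᵥ z + b)) ↔
      EJ (upperPart (Tᵀ * T)) (-(Tᵀ *ᵥ (x - b))) y <
        EJ (upperPart (Tᵀ * T)) (-(Tᵀ *ᵥ (x - b))) z := by
  rw [euclNorm, euclNorm, Real.sqrt_lt_sqrt_iff (Finset.sum_nonneg fun i _ => sq_nonneg _),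
    hy.sum_sq_sub_eq, hz.sum_sq_sub_eq]
  constructor <;> intro h <;> linarith

/-- The transpose of an injective real matrix is surjective. -/
lemma Matrix.mulVec_transpose_surjective_of_injective {n m : ℕ} {T : Matrix (Fin n) (Fin m) ℝ}
    (hT : Function.Injective T.mulVec) : Function.Surjective Tᵀ.mulVec := by
  have hinj : Function.Injective (Tᵀ * T).mulVec := by
    have hker : LinearMap.ker T.mulVecLin = ⊥ := LinearMap.ker_eq_bot.2 hT
    rw [← Matrix.ker_mulVecLin_transpose_mul_self] at hker
    exact LinearMap.ker_eq_bot.1 hker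
  have hsurj : Function.Surjective (Tᵀ * T).mulVec :=
    Matrix.mulVec_surjective_iff_isUnit.2 (Matrix.mulVec_injective_iff_isUnit.1 hinj)
  intro a
  obtain ⟨w, hw⟩ := hsurj a
  exact ⟨T *ᵥ w, by rw [Matrix.mulVec_mulVec, hw]⟩

/-- for an injective affine map `B(y) = T y + b` and spin state `y`, the image
of the Voronoi cell of `B y` in `B(Σᵐ)` under `x ↦ −B*(x)` (with `B*(x) = Tᵀ(x − b)`)
equals the minimizing cell `C_{J_T}(y)`, where `J_T` is the strictly upper part of `TᵀT`. -/
theorem statement7 (n m : ℕ) (T : Matrix (Fin n) (Fin m) ℝ) (b : Fin n → ℝ)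
    (hB : Function.Injective (fun y : Fin m → ℝ => T.mulVec y + b))
    (y : Fin m → ℝ) (hy : IsSpin y) :
    (fun x : Fin n → ℝ => -(Tᵀ.mulVec (x - b))) ''
        VorCell ((fun z : Fin m → ℝ => T.mulVec z + b) '' {z | IsSpin z})
          (T.mulVec y + b)
      = MinCell (upperPart (Tᵀ * T)) y := by
  have hVor : ∀ x, x ∈ VorCell ((fun z : Fin m → ℝ => T.mulVec z + b) '' {z | IsSpin z})
      (T.mulVec y + b) ↔ -(Tᵀ.mulVec (x - b)) ∈ MinCell (upperPart (Tᵀ * T)) y := by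
    intro x
    simp only [VorCell, MinCell, Set.mem_ofPred_eq, Set.forall_mem_image]
    refine forall₂_congr fun z hz => ?_
    rw [euclNorm_sub_lt_iff_EJ_lt T b x hy hz, hB.ne_iff' rfl]
  ext a
  constructor
  · rintro ⟨x, hx, rfl⟩
    exact (hVor x).1 hx
  · intro ha
    have hT : Function.Injective T.mulVec := fun u v huv => hB (congrArg (· + b) huv)
    obtain ⟨w, hw⟩ := Matrix.mulVec_transpose_surjective_of_injective hT (-a)
    have hwa : -(Tᵀ.mulVec (w + b - b)) = a := by rw [add_sub_cancel_right, hw, neg_neg]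
    exact ⟨w + b, (hVor _).2 (hwa.symm ▸ ha), hwa⟩
end

section
/- If a circuit (n,m,f) is Voronoi feasible, then it is feasible. Furthermore, if B(y) = Ty + b is an injective Voronoi solution for (n,m,f), then the Ising Hamiltonian H(x,y) = −B*(x)·y + yᵀ J_T y encodes (n,m,f), where B*(x) = Tᵀ(x − b) and J_T is the strictly upper-triangular part of TᵀT. -/
open Finset Matrix

/-- An Ising Hamiltonian `H(x,y) = A(x)·y + yᵀJy` with `A(x) = T x + c`. -/
noncomputable def isingH2 {n m : ℕ} (T : Matrix (Fin m) (Fin n) ℝ) (c : Fin m → ℝ)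
    (J : Matrix (Fin m) (Fin m) ℝ) (x : Fin n → ℝ) (y : Fin m → ℝ) : ℝ :=
  EJ J (T.mulVec x + c) y

def Encodes2 {n m : ℕ} (H : (Fin n → ℝ) → (Fin m → ℝ) → ℝ)
    (f : (Fin n → ℝ) → (Fin m → ℝ)) : Prop :=
  ∀ x, IsSpin x → ∀ y, IsSpin y → y ≠ f x → H x (f x) < H x y

def Feasible2 (n m : ℕ) (f : (Fin n → ℝ) → (Fin m → ℝ)) : Prop :=
  ∃ (T : Matrix (Fin m) (Fin n) ℝ) (c : Fin m → ℝ) (J : Matrix (Fin m) (Fin m) ℝ),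
    StrictUpper J ∧ Encodes2 (isingH2 T c J) f

/-- `B(y) = T y + b` is a Voronoi solution for `(n,m,f)`. -/
def VoronoiSolution {n m : ℕ} (f : (Fin n → ℝ) → (Fin m → ℝ))
    (T : Matrix (Fin n) (Fin m) ℝ) (b : Fin n → ℝ) : Prop :=
  ∀ x, IsSpin x → ∀ y, IsSpin y → y ≠ f x →
    euclNorm (x - (T.mulVec (f x) + b)) < euclNorm (x - (T.mulVec y + b))

theorem IsSpin.mul_self {d : ℕ} {s : Fin d → ℝ} (hs : IsSpin s) (i : Fin d) :
    s i * s i = 1 := by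
  rcases hs i with h | h <;> simp [h]

theorem strictUpper_upperPart {m : ℕ} (M : Matrix (Fin m) (Fin m) ℝ) :
    StrictUpper (upperPart M) := fun i j h => by simp [upperPart, h]

/-- On spin vectors a symmetric quadratic form is its trace plus twice its strictly upper part. -/
theorem Matrix.IsSymm.sum_mul_spin {m : ℕ} {M : Matrix (Fin m) (Fin m) ℝ} (hM : M.IsSymm)
    {y : Fin m → ℝ} (hy : IsSpin y) :
    ∑ i, ∑ j, M i j * y i * y j =
      M.trace + 2 * ∑ i, ∑ j, upperPart M i j * y i * y j := by
  have hsplit : ∀ i j, M i j * y i * y j =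
      (if i = j then M i i else 0) + upperPart M i j * y i * y j +
        upperPart M j i * y j * y i := by
    intro i j
    rcases lt_trichotomy i j with h | rfl | h
    · simp [upperPart, h, h.ne, h.not_gt]
    · simp [upperPart, mul_assoc, hy.mul_self]
    · simp only [upperPart, of_apply, h.ne', h.not_gt, h, if_true, if_false, hM.apply i j]
      ring
  have hswap : ∑ i, ∑ j, upperPart M j i * y j * y i =
      ∑ i, ∑ j, upperPart M i j * y i * y j := Finset.sum_comm
  simp_rw [hsplit, Finset.sum_add_distrib, hswap]
  simp only [Finset.sum_ite_eq, Finset.mem_univ, if_true, Matrix.trace, Matrix.diag_apply]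
  ring

/-- The squared distance from `x` to `T y + b` is, up to a constant independent of the spin
vector `y`, twice the Hamiltonian `−B*(x)·y + yᵀ J_T y`. -/
theorem sum_sq_sub_mulVec_add {n m : ℕ} (T : Matrix (Fin n) (Fin m) ℝ) (b x : Fin n → ℝ)
    {y : Fin m → ℝ} (hy : IsSpin y) :
    ∑ i, ((x - (T.mulVec y + b)) i) ^ 2 =
      (x - b) ⬝ᵥ (x - b) + (Tᵀ * T).trace +
        2 * EJ (upperPart (Tᵀ * T)) (-(Tᵀ.mulVec (x - b))) y := by
  have hsymm : (Tᵀ * T).IsSymm := by simp [Matrix.IsSymm]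
  have hquad : (T *ᵥ y) ⬝ᵥ (T *ᵥ y) = ∑ i, ∑ j, (Tᵀ * T) i j * y i * y j := by
    rw [Matrix.dotProduct_mulVec, ← Matrix.mulVec_transpose, Matrix.mulVec_mulVec]
    simp only [dotProduct, Matrix.mulVec, Finset.sum_mul]
    rw [Finset.sum_comm]
    refine Finset.sum_congr rfl fun i _ => Finset.sum_congr rfl fun j _ => ?_
    rw [hsymm.apply i j]
  have hlin : (x - b) ⬝ᵥ (T *ᵥ y) = (Tᵀ *ᵥ (x - b)) ⬝ᵥ y := by
    rw [Matrix.dotProduct_mulVec, Matrix.mulVec_transpose]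
  have hsq : ∑ i, ((x - (T.mulVec y + b)) i) ^ 2 =
      (x - b - T *ᵥ y) ⬝ᵥ (x - b - T *ᵥ y) := by
    refine Finset.sum_congr rfl fun i _ => ?_
    simp only [Pi.sub_apply, Pi.add_apply]
    ring
  have hneg : ∑ i, (-(Tᵀ *ᵥ (x - b))) i * y i = -((Tᵀ *ᵥ (x - b)) ⬝ᵥ y) :=
    neg_dotProduct _ _
  rw [hsq, sub_dotProduct, dotProduct_sub (x - b), dotProduct_sub (T *ᵥ y),
    dotProduct_comm (T *ᵥ y) (x - b), hlin, hquad,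
    hsymm.sum_mul_spin hy, EJ, hneg]
  ring

theorem VoronoiSolution.encodes {n m : ℕ} {f : (Fin n → ℝ) → (Fin m → ℝ)}
    (hf : ∀ x, IsSpin x → IsSpin (f x)) {T : Matrix (Fin n) (Fin m) ℝ} {b : Fin n → ℝ}
    (h : VoronoiSolution f T b) :
    Encodes2 (fun x y => EJ (upperPart (Tᵀ * T)) (-(Tᵀ.mulVec (x - b))) y) f := by
  intro x hx y hy hne
  have hlt := h x hx y hy hne
  rw [euclNorm, euclNorm, Real.sqrt_lt_sqrt_iff (Finset.sum_nonneg fun i _ => sq_nonneg _),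
    sum_sq_sub_mulVec_add T b x (hf x hx), sum_sq_sub_mulVec_add T b x hy] at hlt
  linarith

/-- Voronoi feasibility implies feasibility; moreover if `B(y) = Ty + b` is an
injective Voronoi solution then `H(x,y) = −B*(x)·y + yᵀ J_T y` encodes `(n,m,f)`, where
`B*(x) = Tᵀ(x − b)` and `J_T` is the strictly upper part of `TᵀT`. -/
theorem statement9 (n m : ℕ) (f : (Fin n → ℝ) → (Fin m → ℝ))
    (hf : ∀ x, IsSpin x → IsSpin (f x)) :
    ((∃ (T : Matrix (Fin n) (Fin m) ℝ) (b : Fin n → ℝ), VoronoiSolution f T b) →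
      Feasible2 n m f) ∧
    (∀ (T : Matrix (Fin n) (Fin m) ℝ) (b : Fin n → ℝ),
      VoronoiSolution f T b →
      Function.Injective (fun y : Fin m → ℝ => T.mulVec y + b) →
      Encodes2
        (fun x y => (∑ i, (-(Tᵀ.mulVec (x - b))) i * y i) +
          ∑ i, ∑ j, upperPart (Tᵀ * T) i j * y i * y j) f) := by
  refine ⟨?_, fun T b h _ => h.encodes hf⟩
  rintro ⟨T, b, h⟩
  refine ⟨-Tᵀ, Tᵀ *ᵥ b, upperPart (Tᵀ * T), strictUpper_upperPart _, ?_⟩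
  intro x hx y hy hne
  have haffine : (-Tᵀ) *ᵥ x + Tᵀ *ᵥ b = -(Tᵀ *ᵥ (x - b)) := by
    rw [Matrix.neg_mulVec, Matrix.mulVec_sub]
    abel
  simpa only [isingH2, haffine] using h.encodes hf x hx y hy hne
end

section
/- Let a ∈ ℝ^m, let J ∈ ℝ^{m×m} be strictly upper-triangular, and let z ∈ Σ^m. If E_J(a,z) − E_J(a,y) < (z−y)ᵀ J (z−y) for every y ∈ Σ^m with y ≠ z, then E_J(a,·) has no local minima apart from z, i.e., every local minimum of E_J(a,·) equals z. -/
open Finset Matrix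

/-- `z` differs from `y` in exactly one coordinate (Hamming distance 1). -/
def OneFlip {m : ℕ} (y z : Fin m → ℝ) : Prop :=
  ∃ i, z i ≠ y i ∧ ∀ j, j ≠ i → z j = y j

/-- `y` is a local minimum of the energy `E` on spin states. -/
def IsLocMin {m : ℕ} (E : (Fin m → ℝ) → ℝ) (y : Fin m → ℝ) : Prop :=
  ∀ z, IsSpin z → OneFlip y z → E y ≤ E z

/-- Exact second-order expansion of the residual Hamiltonian around `y`. -/
lemma EJ_sub {m : ℕ} (J : Matrix (Fin m) (Fin m) ℝ) (a y z : Fin m → ℝ) :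
    EJ J a z - EJ J a y =
      ∑ i, (z i - y i) * (a i + ∑ j, (J i j + J j i) * y j) +
        ∑ i, ∑ j, (z i - y i) * J i j * (z j - y j) := by
  have hswap : ∑ i, ∑ j, (z i - y i) * (J j i * y j) =
      ∑ i, ∑ j, (z j - y j) * (J i j * y i) := sum_comm
  have hsplit : ∑ i, (z i - y i) * (a i + ∑ j, (J i j + J j i) * y j) =
      ∑ i, (z i - y i) * a i + ∑ i, ∑ j, (z i - y i) * (J i j * y j) +
        ∑ i, ∑ j, (z i - y i) * (J j i * y j) := by
    simp only [mul_add, add_mul, sum_add_distrib, mul_sum, add_assoc]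
  rw [hsplit, hswap]
  unfold EJ
  rw [add_sub_add_comm]
  simp only [← sum_add_distrib, ← sum_sub_distrib]
  refine sum_congr rfl fun i _ => ?_
  rw [add_assoc, add_assoc, ← sum_add_distrib, ← sum_add_distrib]
  congr 1
  · ring
  · exact sum_congr rfl fun j _ => by ring

/-- Changing a single coordinate of `y` changes the energy by the first-order term only, since
`J` has zero diagonal. -/
lemma EJ_update_sub {m : ℕ} {J : Matrix (Fin m) (Fin m) ℝ} (hJ : StrictUpper J)
    (a y : Fin m → ℝ) (k : Fin m) (t : ℝ) :
    EJ J a (Function.update y k t) - EJ J a y =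
      (t - y k) * (a k + ∑ j, (J k j + J j k) * y j) := by
  have hoff : ∀ i, i ≠ k → Function.update y k t i - y i = 0 := fun i hi => by simp [hi]
  have hquad : ∑ i, ∑ j, (Function.update y k t i - y i) * J i j *
      (Function.update y k t j - y j) = 0 := by
    refine sum_eq_zero fun i _ => sum_eq_zero fun j _ => ?_
    rcases eq_or_ne i k with rfl | hi
    · rcases eq_or_ne j i with rfl | hj
      · simp [hJ j j (lt_irrefl j)]
      · rw [hoff j hj, mul_zero]
    · simp [hoff i hi]
  rw [EJ_sub, hquad, add_zero,
    sum_eq_single k (fun i _ hi => by rw [hoff i hi, zero_mul]) (by simp),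
    Function.update_self]

/-- if `E_J(a,z) − E_J(a,y) < (z−y)ᵀ J (z−y)` for every spin `y ≠ z`,
then `E_J(a,·)` has no local minima apart from `z`. -/
theorem statement11 (m : ℕ) (a : Fin m → ℝ) (J : Matrix (Fin m) (Fin m) ℝ)
    (hJ : StrictUpper J) (z : Fin m → ℝ) (hz : IsSpin z)
    (hgap : ∀ y, IsSpin y → y ≠ z →
      EJ J a z - EJ J a y < ∑ i, ∑ j, (z i - y i) * J i j * (z j - y j)) :
    ∀ y, IsSpin y → IsLocMin (EJ J a) y → y = z := by
  intro y hy hmin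
  by_contra hne
  have hlt := hgap y hy hne
  rw [EJ_sub] at hlt
  have hnonneg : 0 ≤ ∑ i, (z i - y i) * (a i + ∑ j, (J i j + J j i) * y j) := by
    refine sum_nonneg fun k _ => ?_
    by_cases hk : z k = y k
    · simp [hk]
    · rw [← EJ_update_sub hJ, sub_nonneg]
      refine hmin _ (fun i => ?_) ⟨k, by simpa using hk, fun j hj => by simp [hj]⟩
      rcases eq_or_ne i k with rfl | hi
      · simpa using hz i
      · simpa [hi] using hy i
  linarith
end

section
/- Let H(x,y) = A(x)·y + yᵀJy be an Ising Hamiltonian (A affine, J strictly upper-triangular) that encodes the circuit (n,m,f). For x ∈ Σ^n, if H(x,f(x)) − H(x,y) < (f(x)−y)ᵀ J (f(x)−y) for every y ∈ Σ^m with y ≠ f(x), then H(x,·) has no local minima apart from f(x). -/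
open Finset Matrix

/-- The gradient at `y` of the energy `a · y + yᵀ J y`. -/
noncomputable def gradEJ {m : ℕ} (J : Matrix (Fin m) (Fin m) ℝ) (a y : Fin m → ℝ) (i : Fin m) : ℝ :=
  a i + ∑ j, (J i j + J j i) * y j

/-- Second-order expansion of the energy around `y`. -/
lemma EJ_add {m : ℕ} (J : Matrix (Fin m) (Fin m) ℝ) (a y d : Fin m → ℝ) :
    EJ J a (y + d) = EJ J a y + ∑ i, gradEJ J a y i * d i + ∑ i, ∑ j, d i * J i j * d j := by
  have hcomm : ∑ i, ∑ j, J j i * y j * d i = ∑ i, ∑ j, J i j * y i * d j := Finset.sum_comm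
  have hgrad : ∑ i, gradEJ J a y i * d i =
      ∑ i, a i * d i + (∑ i, ∑ j, J i j * y j * d i + ∑ i, ∑ j, J i j * y i * d j) := by
    rw [← hcomm]
    simp only [gradEJ, add_mul, Finset.sum_mul, Finset.sum_add_distrib]
  have hquad : ∑ i, ∑ j, J i j * (y i + d i) * (y j + d j) =
      ∑ i, ∑ j, J i j * y i * y j + ∑ i, ∑ j, J i j * y j * d i +
        ∑ i, ∑ j, J i j * y i * d j + ∑ i, ∑ j, d i * J i j * d j := by
    simp only [← Finset.sum_add_distrib]
    exact Finset.sum_congr rfl fun i _ => Finset.sum_congr rfl fun j _ => by ring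
  rw [hgrad]
  simp only [EJ, Pi.add_apply, hquad, mul_add (a _), Finset.sum_add_distrib]
  ring

/-- A change of a single coordinate changes the energy by a linear amount. -/
lemma EJ_add_single {m : ℕ} {J : Matrix (Fin m) (Fin m) ℝ} (hJ : StrictUpper J)
    (a y : Fin m → ℝ) (i : Fin m) (t : ℝ) :
    EJ J a (y + Pi.single i t) = EJ J a y + gradEJ J a y i * t := by
  simp [EJ_add, Pi.single_apply, hJ i i (lt_irrefl i)]

/-- At a local minimum, moving any coordinate towards another spin state does not decrease the
energy to first order. -/
lemma IsLocMin.gradEJ_mul_sub_nonneg {m : ℕ} {J : Matrix (Fin m) (Fin m) ℝ} (hJ : StrictUpper J)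
    {a y w : Fin m → ℝ} (hy : IsSpin y) (hw : IsSpin w) (hmin : IsLocMin (EJ J a) y) (i : Fin m) :
    0 ≤ gradEJ J a y i * (w i - y i) := by
  by_cases h : w i = y i
  · simp [h]
  have hi : (y + Pi.single i (w i - y i) : Fin m → ℝ) i = w i := by simp
  have hne : ∀ j, j ≠ i → (y + Pi.single i (w i - y i) : Fin m → ℝ) j = y j := fun j hj => by simp [hj]
  have hspin : IsSpin (y + Pi.single i (w i - y i)) := fun j => by
    by_cases hj : j = i
    · subst hj
      rw [hi]
      exact hw j
    · rw [hne j hj]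
      exact hy j
  have hle := hmin _ hspin ⟨i, by rwa [hi], hne⟩
  rw [EJ_add_single hJ] at hle
  linarith

/-- suppose `H(x,y) = A(x)·y + yᵀJy` encodes `(n,m,f)`. For a spin input `x`,
if `H(x,f(x)) − H(x,y) < (f(x)−y)ᵀ J (f(x)−y)` for every spin `y ≠ f x`, then `H(x,·)` has
no local minima apart from `f x`. -/
theorem statement12 (n m : ℕ) (f : (Fin n → ℝ) → (Fin m → ℝ))
    (hf : ∀ x, IsSpin x → IsSpin (f x))
    (T : Matrix (Fin m) (Fin n) ℝ) (c : Fin m → ℝ) (J : Matrix (Fin m) (Fin m) ℝ)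
    (hJ : StrictUpper J) (henc : Encodes2 (isingH2 T c J) f)
    (x : Fin n → ℝ) (hx : IsSpin x)
    (hgap : ∀ y, IsSpin y → y ≠ f x →
      isingH2 T c J x (f x) - isingH2 T c J x y <
        ∑ i, ∑ j, (f x i - y i) * J i j * (f x j - y j)) :
    ∀ y, IsSpin y → IsLocMin (isingH2 T c J x) y → y = f x := by
  intro y hy hmin
  by_contra hne
  have hlt := hgap y hy hne
  have hexp := EJ_add J (T.mulVec x + c) y (f x - y)
  rw [add_sub_cancel] at hexp
  have hnonneg : 0 ≤ ∑ i, gradEJ J (T.mulVec x + c) y i * (f x - y) i :=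
    Finset.sum_nonneg fun i _ =>
      IsLocMin.gradEJ_mul_sub_nonneg hJ hy (hf x hx) hmin i
  simp only [isingH2, Pi.sub_apply] at hlt hexp hnonneg
  linarith
end

section
/- Every circuit of shape (1,m) is feasible; that is, for every m ∈ ℕ and every function f : Σ → Σ^m, there exists an Ising Hamiltonian encoding (1,m,f). -/
open Finset

/-- The couplings that join the first spin to the `i`-th remaining spin with strength `c i`. -/
def starCoupling {m : ℕ} (c : Fin m → ℝ) : Matrix (Fin (1 + m)) (Fin (1 + m)) ℝ :=
  Fin.append (fun _ => Fin.append 0 c) 0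

lemma strictUpper_starCoupling {m : ℕ} (c : Fin m → ℝ) : StrictUpper (starCoupling c) := by
  intro i j hij
  induction i using Fin.addCases with
  | left i =>
    induction j using Fin.addCases with
    | left j => simp [starCoupling]
    | right j =>
      refine absurd ?_ hij
      simp only [Fin.lt_def, Fin.val_castAdd, Fin.val_natAdd]
      omega
  | right i => simp [starCoupling]

lemma isingH_starCoupling {m : ℕ} (h c : Fin m → ℝ) (x : Fin 1 → ℝ) (y : Fin m → ℝ) :
    isingH (Fin.append 0 h) (starCoupling c) (Fin.append x y)
      = ∑ i, (h i + c i * x 0) * y i := by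
  have hlt (j : Fin m) : Fin.castAdd m (0 : Fin 1) < Fin.natAdd 1 j := by
    simp only [Fin.lt_def, Fin.val_castAdd, Fin.val_natAdd]
    omega
  simp only [isingH, starCoupling, Fin.sum_univ_add, Fin.append_left, Fin.append_right,
    Fin.sum_univ_one, hlt, Pi.zero_apply, zero_mul, ite_self, if_true, sum_const_zero,
    zero_add, add_zero]
  rw [← sum_add_distrib]
  exact sum_congr rfl fun i _ => by ring

/-- A spin vector is the unique maximizer of the inner product with itself. -/
lemma IsSpin.sum_mul_lt {m : ℕ} {s y : Fin m → ℝ} (hs : IsSpin s) (hy : IsSpin y)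
    (hne : y ≠ s) : ∑ i, s i * y i < ∑ i, s i * s i := by
  obtain ⟨k, hk⟩ := Function.ne_iff.mp hne
  refine sum_lt_sum (fun i _ => ?_) ⟨k, mem_univ k, ?_⟩
  · rcases hs i with h | h <;> rcases hy i with h' | h' <;> rw [h, h'] <;> norm_num
  · rcases hs k with h | h <;> rcases hy k with h' | h' <;> rw [h, h'] at hk ⊢ <;>
      first | exact absurd rfl hk | norm_num

/-- every circuit of shape `(1, m)` is feasible. -/
theorem statement15 (m : ℕ) (f : (Fin 1 → ℝ) → (Fin m → ℝ))
    (hf : ∀ x, IsSpin x → IsSpin (f x)) :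
    Feasible 1 m f := by
  let h : Fin m → ℝ := fun i => -(f 1 i + f (-1) i) / 2
  let c : Fin m → ℝ := fun i => -(f 1 i - f (-1) i) / 2
  refine ⟨Fin.append 0 h, starCoupling c, strictUpper_starCoupling c, fun x hx y hy hne => ?_⟩
  have hfield (i : Fin m) : h i + c i * x 0 = -f x i := by
    rcases hx 0 with h0 | h0
    · have hx' : x = -1 := by ext j; rw [Subsingleton.elim j 0, h0]; rfl
      simp only [h, c, hx', Pi.neg_apply, Pi.one_apply]
      ring
    · have hx' : x = 1 := by ext j; rw [Subsingleton.elim j 0, h0]; rfl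
      simp only [h, c, hx', Pi.one_apply]
      ring
  simp only [isingH_starCoupling, hfield, neg_mul, sum_neg_distrib, neg_lt_neg_iff]
  exact (hf x hx).sum_mul_lt hy hne
end

section
/- A circuit (2,1,f) is infeasible if and only if f is XOR or −XOR; that is, (2,1,f) is feasible if and only if it is not the case that f(x₁,x₂) = −x₁x₂ for all (x₁,x₂) ∈ Σ² and not the case that f(x₁,x₂) = x₁x₂ for all (x₁,x₂) ∈ Σ². -/
open Finset

theorem isingH_append_two_one (h : Fin (2 + 1) → ℝ) (J : Matrix (Fin (2 + 1)) (Fin (2 + 1)) ℝ)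
    (x : Fin 2 → ℝ) (y : Fin 1 → ℝ) :
    isingH h J (Fin.append x y) =
      (h 0 * x 0 + h 1 * x 1 + J 0 1 * x 0 * x 1) + (h 2 + J 0 2 * x 0 + J 1 2 * x 1) * y 0 := by
  have e0 : Fin.append x y 0 = x 0 := Fin.append_left x y 0
  have e1 : Fin.append x y 1 = x 1 := Fin.append_left x y 1
  have e2 : Fin.append x y 2 = y 0 := Fin.append_right x y 0
  simp only [isingH, Nat.reduceAdd, Fin.sum_univ_three, e0, e1, e2]
  simp
  ring

/-- A two-input, one-output circuit is feasible iff its negation is a linear threshold function. -/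
theorem feasible_two_one_iff (f : (Fin 2 → ℝ) → (Fin 1 → ℝ))
    (hf : ∀ x, IsSpin x → IsSpin (f x)) :
    Feasible 2 1 f ↔
      ∃ a b c : ℝ, ∀ x, IsSpin x → (a + b * x 0 + c * x 1) * f x 0 < 0 := by
  constructor
  · rintro ⟨h, J, -, hE⟩
    refine ⟨h 2, J 0 2, J 1 2, fun x hx => ?_⟩
    have hs := hf x hx 0
    have hneg : IsSpin (-f x) := fun i => by
      rcases hf x hx i with hi | hi <;> simp [hi]
    have hne : -f x ≠ f x := fun he => by
      have := congrFun he 0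
      rcases hs with hs | hs <;> norm_num [hs] at this
    have hlt := hE x hx _ hneg hne
    rw [isingH_append_two_one, isingH_append_two_one, Pi.neg_apply] at hlt
    linarith
  · rintro ⟨a, b, c, habc⟩
    refine ⟨![0, 0, a], !![0, 0, b; 0, 0, c; 0, 0, 0], ?_, fun x hx y hy hne => ?_⟩
    · intro i j hij
      fin_cases i <;> fin_cases j <;> simp_all
    · have hlt := habc x hx
      have hy0 : y 0 = -f x 0 := by
        have hne0 : y 0 ≠ f x 0 := fun h0 => hne (funext fun i => by rwa [Subsingleton.elim i 0])
        rcases hf x hx 0 with hs | hs <;> rcases hy 0 with ht | ht <;> simp_all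
      rw [isingH_append_two_one, isingH_append_two_one, hy0]
      simp
      linarith

theorem forall_isSpin_two {P : (Fin 2 → ℝ) → Prop} :
    (∀ x, IsSpin x → P x) ↔ P ![-1, -1] ∧ P ![-1, 1] ∧ P ![1, -1] ∧ P ![1, 1] := by
  constructor
  · intro h
    refine ⟨h _ ?_, h _ ?_, h _ ?_, h _ ?_⟩ <;> intro i <;> fin_cases i <;> simp
  · rintro ⟨h₁, h₂, h₃, h₄⟩ x hx
    have hx' : x = ![x 0, x 1] := by
      ext i
      fin_cases i <;> rfl
    rw [hx']
    rcases hx 0 with h0 | h0 <;> rcases hx 1 with h1 | h1 <;> rw [h0, h1] <;> assumption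

/-- a circuit `(2,1,f)` is feasible iff `f` is neither `XOR` nor `−XOR`
(in spin convention `XOR(x₁,x₂) = −x₁x₂`). -/
theorem statement16 (f : (Fin 2 → ℝ) → (Fin 1 → ℝ))
    (hf : ∀ x, IsSpin x → IsSpin (f x)) :
    Feasible 2 1 f ↔
      (¬ (∀ x, IsSpin x → f x 0 = -(x 0 * x 1)) ∧
       ¬ (∀ x, IsSpin x → f x 0 = x 0 * x 1)) := by
  have hp := forall_isSpin_two.1 fun x hx => hf x hx 0
  simp only [feasible_two_one_iff f hf, forall_isSpin_two, Matrix.cons_val_zero,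
    Matrix.cons_val_one]
  generalize f ![-1, -1] 0 = p, f ![-1, 1] 0 = q, f ![1, -1] 0 = r, f ![1, 1] 0 = s at hp ⊢
  obtain ⟨hp, hq, hr, hs⟩ := hp
  constructor
  · rintro ⟨a, b, c, h₁, h₂, h₃, h₄⟩
    constructor <;> rintro ⟨rfl, rfl, rfl, rfl⟩ <;> linarith
  · intro h
    -- the Fourier coefficients of degree at most one of `-f`, up to a factor of 4
    refine ⟨-(p + q + r + s), p + q - r - s, p - q + r - s, ?_⟩
    rcases hp with rfl | rfl <;> rcases hq with rfl | rfl <;> rcases hr with rfl | rfl <;>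
      rcases hs with rfl | rfl <;> first | (norm_num; done) | norm_num at h
end
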